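/- (Chain description for unitary AnchRob.) For the unitary problem (zero processing times, unit deviation, one disruption, integer deadline M), the convex hull of incidence vectors of anchored sets equals { h ∈ [0,1]^J : Σ_{i∈C} h_i ≤ M for every chain C of the subposet (J*, ≺) }, where J* is the set of jobs having at least one predecessor in J (i.e., a predecessor other than s). -/

import Mathlib

open MeasureTheory in
/-- Averaging the shifted ceilings `⌈x - θ⌉` over `θ ∈ [0, 1)` gives back `x`. -/
theorem integrableOn_and_setIntegral_ceil_sub (x : ℝ) :
    IntegrableOn (fun θ : ℝ => (⌈x - θ⌉ : ℝ)) (Set.Ico 0 1) ∧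
      ∫ θ in Set.Ico (0 : ℝ) 1, (⌈x - θ⌉ : ℝ) = x := by
  have h0 := Int.fract_nonneg x
  have h1 := Int.fract_lt_one x
  have hx := Int.floor_add_fract x
  have heq : Set.EqOn (fun θ : ℝ => (⌊x⌋ : ℝ) + (Set.Iio (Int.fract x)).indicator 1 θ)
      (fun θ : ℝ => (⌈x - θ⌉ : ℝ)) (Set.Ico 0 1) := by
    intro θ hθ
    by_cases hlt : θ < Int.fract x
    · have : ⌈x - θ⌉ = ⌊x⌋ + 1 := by
        rw [Int.ceil_eq_iff]
        push_cast
        constructor <;> linarith [hθ.1]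
      simp [hlt, this]
    · have : ⌈x - θ⌉ = ⌊x⌋ := by
        rw [Int.ceil_eq_iff]
        constructor <;> linarith [hθ.2]
      simp [hlt, this]
  have hconst : IntegrableOn (fun _ : ℝ => (⌊x⌋ : ℝ)) (Set.Ico 0 1) := by simp
  have hind : IntegrableOn ((Set.Iio (Int.fract x)).indicator (1 : ℝ → ℝ)) (Set.Ico 0 1) := by
    have : IntegrableOn (1 : ℝ → ℝ) (Set.Ico 0 1) := by
      change IntegrableOn (fun _ : ℝ => (1 : ℝ)) (Set.Ico 0 1)
      simp
    exact this.indicator measurableSet_Iio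
  refine ⟨(hconst.add hind).congr_fun heq measurableSet_Ico, ?_⟩
  rw [← setIntegral_congr_fun measurableSet_Ico heq, integral_add hconst hind,
    setIntegral_indicator measurableSet_Iio]
  have hI : Set.Ico (0 : ℝ) 1 ∩ Set.Iio (Int.fract x) = Set.Ico 0 (Int.fract x) := by
    ext y
    simp only [Set.mem_inter_iff, Set.mem_Ico, Set.mem_Iio]
    constructor
    · rintro ⟨⟨a, -⟩, b⟩
      exact ⟨a, b⟩
    · rintro ⟨a, b⟩
      exact ⟨⟨a, b.trans h1⟩, b⟩
  rw [hI]
  simp [h0, hx]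

/-- A potential `z` that increases by at least `w j` whenever one moves up to `j` dominates
the `w`-weight of every nonempty chain at the top of that chain. -/
theorem exists_top_sum_le_of_isChain {V : Type*} [PartialOrder V] {w z : V → ℝ} (C : Finset V)
    (hC : IsChain (· < ·) (C : Set V)) (hne : C.Nonempty) (hz : ∀ j ∈ C, w j ≤ z j)
    (hw : ∀ i ∈ C, ∀ j ∈ C, i < j → w j ≤ z j - z i) :
    ∃ m ∈ C, ∑ i ∈ C, w i ≤ z m := by
  classical
  induction C using Finset.strongInduction with
  | H C ih =>
    obtain ⟨m, hm⟩ := C.exists_maximal hne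
    have hmC : m ∈ C := hm.1
    refine ⟨m, hmC, ?_⟩
    rw [← Finset.add_sum_erase C w hmC]
    rcases (C.erase m).eq_empty_or_nonempty with he | he
    · simpa [he] using hz m hmC
    · obtain ⟨n, hn, hsum⟩ := ih (C.erase m) (Finset.erase_ssubset hmC)
        (hC.mono (by simp)) he (fun j hj => hz j (Finset.mem_of_mem_erase hj))
        (fun i hi j hj => hw i (Finset.mem_of_mem_erase hi) j (Finset.mem_of_mem_erase hj))
      have hnC := Finset.mem_of_mem_erase hn
      have hnm : n < m := by
        rcases hC hnC hmC (Finset.ne_of_mem_erase hn) with h | h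
        · exact h
        · exact absurd h (hm.not_gt hnC)
      linarith [hw n hnC m hmC hnm]

/-- Weights whose sum along every chain in `P` is at
most `M` admit a monotone potential with values in `[0, M]` that increases by at least `h j`
whenever one moves up to `j ∈ P`, and that vanishes wherever there is no element of `P` below. -/
theorem exists_monotone_potential {V : Type*} [Fintype V] [PartialOrder V] (P : V → Prop)
    (h : V → ℝ) (M : ℝ)
    (hM : ∀ C : Finset V, (∀ c ∈ C, P c) → IsChain (· < ·) (C : Set V) → ∑ i ∈ C, h i ≤ M) :
    ∃ f : V → ℝ, Monotone f ∧ (∀ v, 0 ≤ f v) ∧ (∀ v, f v ≤ M) ∧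
      (∀ i j, i < j → P j → f i + h j ≤ f j) ∧ ∀ v, (∀ c ≤ v, ¬ P c) → f v = 0 := by
  classical
  let S : V → Finset (Finset V) := fun v =>
    Finset.univ.filter fun C => (∀ c ∈ C, P c ∧ c ≤ v) ∧ IsChain (· < ·) (C : Set V)
  have hS : ∀ v C, C ∈ S v ↔ (∀ c ∈ C, P c ∧ c ≤ v) ∧ IsChain (· < ·) (C : Set V) := by
    simp [S]
  have hne : ∀ v, ∅ ∈ S v := by simp [hS]
  let f : V → ℝ := fun v => (S v).sup' ⟨∅, hne v⟩ fun C => ∑ i ∈ C, h i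
  have hle : ∀ v, ∀ C ∈ S v, ∑ i ∈ C, h i ≤ f v := fun v C hC =>
    Finset.le_sup' (fun C => ∑ i ∈ C, h i) hC
  refine ⟨f, ?_, fun v => by simpa using hle v ∅ (hne v), ?_, ?_, ?_⟩
  · intro u v huv
    refine Finset.sup'_le _ _ fun C hC => hle v C ?_
    rw [hS] at hC ⊢
    exact ⟨fun c hc => ⟨(hC.1 c hc).1, (hC.1 c hc).2.trans huv⟩, hC.2⟩
  · intro v
    refine Finset.sup'_le _ _ fun C hC => ?_
    rw [hS] at hC
    exact hM C (fun c hc => (hC.1 c hc).1) hC.2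
  · intro i j hij hj
    rw [← le_sub_iff_add_le]
    refine Finset.sup'_le _ _ fun C hC => ?_
    rw [hS] at hC
    have hlt : ∀ c ∈ C, c < j := fun c hc => (hC.1 c hc).2.trans_lt hij
    have hjC : j ∉ C := fun hc => (hlt j hc).false
    have hmem : insert j C ∈ S j := by
      rw [hS]
      refine ⟨?_, ?_⟩
      · intro c hc
        rcases Finset.mem_insert.1 hc with rfl | hc
        · exact ⟨hj, le_rfl⟩
        · exact ⟨(hC.1 c hc).1, (hlt c hc).le⟩
      · rw [Finset.coe_insert]
        exact hC.2.insert fun c hc _ => Or.inr (hlt c hc)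
    have := hle j _ hmem
    rw [Finset.sum_insert hjC] at this
    linarith
  · intro v hv
    refine le_antisymm (Finset.sup'_le _ _ fun C hC => ?_) (by simpa using hle v ∅ (hne v))
    rw [hS] at hC
    have : C = ∅ := Finset.eq_empty_of_forall_notMem fun c hc =>
      hv c (hC.1 c hc).2 (hC.1 c hc).1
    simp [this]


/-- chain description for the unitary Anchor-Robust problem: the convex
hull of incidence vectors of anchored sets equals the set of `h ∈ [0,1]^J` (extended by
`0` on `s,t`) whose sum along every chain of the subposet `J*` (jobs with a predecessor
in `J`) is at most `M`. Here `H ⊆ J` is anchored iff there is `z ≥ 0` with `z s = 0`,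
`z t ≤ M`, `z_i ≤ z_t`, `z_j − z_i ≥ [j ∈ H]` for `i ≺ j` in `J`, and
`z_j ≥ [j ∈ H]` for `j ∈ J*`. -/
theorem unitary_anchrob_chain_description
    {V : Type*} [Fintype V] [PartialOrder V] (s t : V)
    (hs : ∀ v, s ≤ v) (ht : ∀ v, v ≤ t) (M : ℕ) :
    convexHull ℝ {h : V → ℝ | ∃ H : Set V, s ∉ H ∧ t ∉ H ∧
        (∃ z : V → ℝ, (∀ v, 0 ≤ z v) ∧ z s = 0 ∧ z t ≤ (M : ℝ) ∧
          (∀ i, z i ≤ z t) ∧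
          (∀ i j, i ≠ s → i ≠ t → j ≠ s → j ≠ t → i < j →
            H.indicator 1 j ≤ z j - z i) ∧
          (∀ j, j ≠ s → j ≠ t → (∃ i, i ≠ s ∧ i ≠ t ∧ i < j) →
            H.indicator 1 j ≤ z j)) ∧
        h = H.indicator 1} =
      {h : V → ℝ | (∀ v, 0 ≤ h v ∧ h v ≤ 1) ∧ h s = 0 ∧ h t = 0 ∧
        ∀ C : Finset V,
          (∀ c ∈ C, c ≠ s ∧ c ≠ t ∧ ∃ i, i ≠ s ∧ i ≠ t ∧ i < c) →
          IsChain (· < ·) (↑C : Set V) →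
          ∑ i ∈ C, h i ≤ (M : ℝ)} := by
  apply Set.Subset.antisymm
  · refine convexHull_min ?_ ?_
    · rintro _ ⟨H, hsH, htH, ⟨z, -, -, hzM, hzt, hzJ, hzs⟩, rfl⟩
      refine ⟨fun v => ⟨Set.indicator_nonneg (by simp) v,
        Set.indicator_le_self' (by simp) v⟩, by simp [hsH], by simp [htH], ?_⟩
      intro C hCP hC
      rcases C.eq_empty_or_nonempty with rfl | hne
      · simp
      obtain ⟨m, -, hm⟩ := exists_top_sum_le_of_isChain C hC hne
        (fun j hj => hzs j (hCP j hj).1 (hCP j hj).2.1 (hCP j hj).2.2)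
        (fun i hi j hj => hzJ i j (hCP i hi).1 (hCP i hi).2.1 (hCP j hj).1 (hCP j hj).2.1)
      exact hm.trans ((hzt m).trans hzM)
    · rintro x ⟨hx01, hxs, hxt, hxC⟩ y ⟨hy01, hys, hyt, hyC⟩ a b ha hb hab
      refine ⟨fun v => ?_, by simp [hxs, hys], by simp [hxt, hyt], fun C hCP hC => ?_⟩
      · simp only [Pi.add_apply, Pi.smul_apply, smul_eq_mul]
        have := hx01 v
        have := hy01 v
        constructor <;> nlinarith
      · simp only [Pi.add_apply, Pi.smul_apply, smul_eq_mul, Finset.sum_add_distrib,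
          ← Finset.mul_sum]
        have := hxC C hCP hC
        have := hyC C hCP hC
        have : (M : ℝ) = a * M + b * M := by rw [← add_mul, hab, one_mul]
        nlinarith
  · rintro h ⟨h01, hhs, hht, hhC⟩
    obtain ⟨f, hmono, hf0, hfM, hfh, hfs⟩ := exists_monotone_potential
      (fun c => c ≠ s ∧ c ≠ t ∧ ∃ i, i ≠ s ∧ i ≠ t ∧ i < c) h M hhC
    have hfs0 : f s = 0 := hfs s fun c hc hP => hP.1 (le_antisymm hc (hs c))
    set A : Set (V → ℝ) := {h : V → ℝ | ∃ H : Set V, s ∉ H ∧ t ∉ H ∧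
        (∃ z : V → ℝ, (∀ v, 0 ≤ z v) ∧ z s = 0 ∧ z t ≤ (M : ℝ) ∧
          (∀ i, z i ≤ z t) ∧
          (∀ i j, i ≠ s → i ≠ t → j ≠ s → j ≠ t → i < j →
            H.indicator 1 j ≤ z j - z i) ∧
          (∀ j, j ≠ s → j ≠ t → (∃ i, i ≠ s ∧ i ≠ t ∧ i < j) →
            H.indicator 1 j ≤ z j)) ∧
        h = H.indicator 1}
    have hfin : A.Finite := (Set.finite_range fun H : Set V => H.indicator (1 : V → ℝ)).subset
      fun _ ⟨H, _, _, _, hH⟩ => ⟨H, hH.symm⟩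
    let F : ℝ → V → ℝ := fun θ j => (⌈f j - θ⌉ : ℝ) - ⌈f j - h j - θ⌉
    have hFA : ∀ θ ∈ Set.Ico (0 : ℝ) 1, F θ ∈ A := by
      rintro θ ⟨hθ0, hθ1⟩
      have hFH : F θ = {j | ⌈f j - θ⌉ ≠ ⌈f j - h j - θ⌉}.indicator 1 := by
        funext j
        by_cases hj : ⌈f j - θ⌉ = ⌈f j - h j - θ⌉
        · simp [F, hj]
        · have h1 : ⌈f j - h j - θ⌉ ≤ ⌈f j - θ⌉ := Int.ceil_mono (by linarith [(h01 j).1])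
          have h2 : ⌈f j - θ⌉ ≤ ⌈f j - h j - θ⌉ + 1 := by
            rw [← Int.ceil_add_one]
            exact Int.ceil_mono (by linarith [(h01 j).2])
          have h3 : ⌈f j - θ⌉ = ⌈f j - h j - θ⌉ + 1 := by omega
          rw [Set.indicator_of_mem (by exact hj)]
          simp [F, h3]
      have hceil : ∀ x : ℝ, 0 ≤ x → 0 ≤ ⌈x - θ⌉ := fun x hx => by
        have : -1 < ⌈x - θ⌉ := Int.lt_ceil.2 (by push_cast; linarith)
        omega
      refine ⟨_, by simp [hhs], by simp [hht],
        ⟨fun v => (⌈f v - θ⌉ : ℝ), ?_, ?_, ?_, ?_, ?_, ?_⟩, hFH⟩ <;> beta_reduce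
      · intro v
        exact_mod_cast hceil _ (hf0 v)
      · have h1 := hceil 0 le_rfl
        have h2 : ⌈0 - θ⌉ ≤ 0 := Int.ceil_le.2 (by push_cast; linarith)
        rw [hfs0]
        exact_mod_cast le_antisymm h2 h1
      · have : ⌈f t - θ⌉ ≤ (M : ℤ) := Int.ceil_le.2 (by push_cast; linarith [hfM t])
        exact_mod_cast this
      · intro i
        exact_mod_cast Int.ceil_mono (sub_le_sub_right (hmono (ht i)) θ)
      · intro i j his hit hjs hjt hij
        rw [← hFH]
        have hstep := hfh i j hij ⟨hjs, hjt, i, his, hit, hij⟩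
        have : ⌈f i - θ⌉ ≤ ⌈f j - h j - θ⌉ := Int.ceil_mono (by linarith)
        have : (⌈f i - θ⌉ : ℝ) ≤ ⌈f j - h j - θ⌉ := by exact_mod_cast this
        simp only [F]
        linarith
      · rintro j hjs hjt ⟨i, his, hit, hij⟩
        rw [← hFH]
        have hstep := hfh i j hij ⟨hjs, hjt, i, his, hit, hij⟩
        have : 0 ≤ ⌈f j - h j - θ⌉ := hceil _ (by linarith [hf0 i])
        have : (0 : ℝ) ≤ ⌈f j - h j - θ⌉ := by exact_mod_cast this
        simp only [F]
        linarith
    have hFint : ∀ j, MeasureTheory.IntegrableOn (fun θ => F θ j) (Set.Ico 0 1) := fun j =>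
      (integrableOn_and_setIntegral_ceil_sub (f j)).1.sub
        (integrableOn_and_setIntegral_ceil_sub (f j - h j)).1
    have hmean : ∫ θ in Set.Ico (0 : ℝ) 1, F θ = h := by
      funext j
      rw [MeasureTheory.eval_integral hFint]
      simp only [F]
      rw [MeasureTheory.integral_sub (integrableOn_and_setIntegral_ceil_sub (f j)).1
        (integrableOn_and_setIntegral_ceil_sub (f j - h j)).1,
        (integrableOn_and_setIntegral_ceil_sub (f j)).2,
        (integrableOn_and_setIntegral_ceil_sub (f j - h j)).2]
      ring
    have : MeasureTheory.IsProbabilityMeasure (MeasureTheory.volume.restrict (Set.Ico (0 : ℝ) 1)) := ⟨by simp⟩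
    rw [← hmean]
    exact (convex_convexHull ℝ A).integral_mem (hfin.isClosed_convexHull ℝ)
      ((MeasureTheory.ae_restrict_iff' measurableSet_Ico).2
        (.of_forall fun θ hθ => subset_convexHull ℝ A (hFA θ hθ)))
      (MeasureTheory.Integrable.of_eval hFint)
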